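/- arXiv:1702.07939 — 2 statements merged into one kernel-verified Lean document; each statement's English description precedes it below -/
import Mathlib

section
/- Let Π be a projective plane of order q and let S be a set of points of Π with |S| ≥ 2. Then there exists a saturating set S' of Π with S ⊆ S' and |S'| ≤ |S| + ⌈|R(S)|/2⌉, where R(S) denotes the set of points of Π not in S that do not lie on any line containing at least two points of S. -/
/-- A (not necessarily Desarguesian) projective plane of order `q`:
a finite incidence structure of points and lines such that any two distinct
points lie on a unique common line, any two distinct lines meet in a unique
point, there exist four points no three collinear, and every line contains
exactly `q + 1` points. -/
structure ProjPlane (q : ℕ) where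
  Point : Type
  Line : Type
  finite_point : Finite Point
  finite_line : Finite Line
  incid : Point → Line → Prop
  line_unique : ∀ P Q : Point, P ≠ Q → ∃! l : Line, incid P l ∧ incid Q l
  point_unique : ∀ l m : Line, l ≠ m → ∃! P : Point, incid P l ∧ incid P m
  nondeg : ∃ P₁ P₂ P₃ P₄ : Point,
    P₁ ≠ P₂ ∧ P₁ ≠ P₃ ∧ P₁ ≠ P₄ ∧ P₂ ≠ P₃ ∧ P₂ ≠ P₄ ∧ P₃ ≠ P₄ ∧
    (∀ l : Line, ¬(incid P₁ l ∧ incid P₂ l ∧ incid P₃ l)) ∧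
    (∀ l : Line, ¬(incid P₁ l ∧ incid P₂ l ∧ incid P₄ l)) ∧
    (∀ l : Line, ¬(incid P₁ l ∧ incid P₃ l ∧ incid P₄ l)) ∧
    (∀ l : Line, ¬(incid P₂ l ∧ incid P₃ l ∧ incid P₄ l))
  line_card : ∀ l : Line, Nat.card {P : Point // incid P l} = q + 1

/-- A point set `S` is saturating if every point of the plane not in `S`
lies on a line containing at least two points of `S`. -/
def ProjPlane.Saturating {q : ℕ} (PP : ProjPlane q) (S : Set PP.Point) : Prop :=
  ∀ Q : PP.Point, Q ∉ S → ∃ A ∈ S, ∃ B ∈ S, A ≠ B ∧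
    ∃ l : PP.Line, PP.incid A l ∧ PP.incid B l ∧ PP.incid Q l

/-- `R(T)`: the set of points of the plane not in `T` that do not lie on any
line containing at least two points of `T` (the points not covered by `T`). -/
def ProjPlane.uncov {q : ℕ} (PP : ProjPlane q) (T : Set PP.Point) : Set PP.Point :=
  {Q : PP.Point | Q ∉ T ∧ ¬ ∃ A ∈ T, ∃ B ∈ T, A ≠ B ∧
    ∃ l : PP.Line, PP.incid A l ∧ PP.incid B l ∧ PP.incid Q l}

namespace ProjPlane

variable {q : ℕ} (PP : ProjPlane q)

lemma saturating_of_uncov_eq_empty {S : Set PP.Point} (h : PP.uncov S = ∅) :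
    PP.Saturating S := by
  intro Q hQ
  by_contra hc
  exact h.le (show Q ∈ PP.uncov S from ⟨hQ, hc⟩)

lemma uncov_anti {S T : Set PP.Point} (h : S ⊆ T) : PP.uncov T ⊆ PP.uncov S := by
  rintro Q ⟨hQ, hc⟩
  refine ⟨fun hQS => hQ (h hQS), ?_⟩
  rintro ⟨A, hA, B, hB, hAB⟩
  exact hc ⟨A, h hA, B, h hB, hAB⟩

/-- Two uncovered points `P` and `Q` both cease to be uncovered on adding the intersection of
the lines `AP` and `BQ`, where `A` and `B` are distinct points of the set. -/
lemma exists_insert_covers_pair {S : Set PP.Point} {A B P Q : PP.Point} (hA : A ∈ S) (hB : B ∈ S)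
    (hAB : A ≠ B) (hP : P ∈ PP.uncov S) (hQ : Q ∈ PP.uncov S) :
    ∃ X, P ∉ PP.uncov (insert X S) ∧ Q ∉ PP.uncov (insert X S) := by
  have hAP : A ≠ P := fun h => hP.1 (h ▸ hA)
  have hBQ : B ≠ Q := fun h => hQ.1 (h ▸ hB)
  obtain ⟨l, ⟨hAl, hPl⟩, -⟩ := PP.line_unique A P hAP
  obtain ⟨m, ⟨hBm, hQm⟩, -⟩ := PP.line_unique B Q hBQ
  have hBl : ¬ PP.incid B l := fun h => hP.2 ⟨A, hA, B, hB, hAB, l, hAl, h, hPl⟩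
  have hAm : ¬ PP.incid A m := fun h => hQ.2 ⟨A, hA, B, hB, hAB, m, h, hBm, hQm⟩
  have hlm : l ≠ m := fun h => hAm (h ▸ hAl)
  obtain ⟨X, ⟨hXl, hXm⟩, -⟩ := PP.point_unique l m hlm
  refine ⟨X, fun h => h.2 ?_, fun h => h.2 ?_⟩
  · exact ⟨A, .inr hA, X, .inl rfl, fun e => hAm (e ▸ hXm), l, hAl, hXl, hPl⟩
  · exact ⟨B, .inr hB, X, .inl rfl, fun e => hBl (e ▸ hXl), m, hBm, hXm, hQm⟩

lemma exists_insert_ncard_uncov_le {S : Set PP.Point} (hS : 2 ≤ S.ncard) {k : ℕ}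
    (hk : (PP.uncov S).ncard ≤ k + 2) (hne : (PP.uncov S).Nonempty) :
    ∃ X, (PP.uncov (insert X S)).ncard ≤ k := by
  have := PP.finite_point
  obtain ⟨P, hP⟩ := hne
  by_cases hsub : ∃ Q ∈ PP.uncov S, P ≠ Q
  · obtain ⟨Q, hQ, hPQ⟩ := hsub
    obtain ⟨A, hA, B, hB, hAB⟩ := Set.one_lt_ncard_iff_nontrivial.1 hS
    obtain ⟨X, hPX, hQX⟩ := PP.exists_insert_covers_pair hA hB hAB hP hQ
    refine ⟨X, ?_⟩
    have hsubset : PP.uncov (insert X S) ⊆ PP.uncov S \ {P, Q} := by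
      intro Y hY
      refine ⟨PP.uncov_anti (Set.subset_insert X S) hY, ?_⟩
      rintro (rfl | rfl)
      exacts [hPX hY, hQX hY]
    have hle := Set.ncard_le_ncard hsubset (Set.toFinite _)
    rw [Set.ncard_sdiff (Set.pair_subset hP hQ) (Set.toFinite _), Set.ncard_pair hPQ] at hle
    omega
  · push Not at hsub
    refine ⟨P, ?_⟩
    have hempty : PP.uncov (insert P S) = ∅ := by
      refine Set.eq_empty_of_forall_notMem fun Y hY => hY.1 (.inl ?_)
      exact (hsub Y (PP.uncov_anti (Set.subset_insert P S) hY)).symm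
    simp [hempty]

lemma exists_saturating_superset (k : ℕ) (S : Set PP.Point) (hS : 2 ≤ S.ncard)
    (hk : (PP.uncov S).ncard ≤ 2 * k) :
    ∃ S', PP.Saturating S' ∧ S ⊆ S' ∧ S'.ncard ≤ S.ncard + k := by
  have := PP.finite_point
  induction k generalizing S with
  | zero =>
    have h : PP.uncov S = ∅ := (Set.ncard_eq_zero (Set.toFinite _)).1 (by omega)
    exact ⟨S, PP.saturating_of_uncov_eq_empty h, subset_rfl, le_rfl⟩
  | succ k ih =>
    rcases (PP.uncov S).eq_empty_or_nonempty with h | h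
    · exact ⟨S, PP.saturating_of_uncov_eq_empty h, subset_rfl, by omega⟩
    · obtain ⟨X, hX⟩ := PP.exists_insert_ncard_uncov_le hS hk h
      have hcard := Set.ncard_le_ncard (Set.subset_insert X S) (Set.toFinite _)
      obtain ⟨S', hsat, hsub, hle⟩ := ih (insert X S) (by omega) hX
      have := Set.ncard_insert_le X S
      exact ⟨S', hsat, (Set.subset_insert X S).trans hsub, by omega⟩

end ProjPlane

theorem complete_to_saturating (q : ℕ) (PP : ProjPlane q)
    (S : Set PP.Point) (hS : 2 ≤ S.ncard) :
    ∃ S' : Set PP.Point, PP.Saturating S' ∧ S ⊆ S' ∧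
      (S'.ncard : ℤ) ≤ (S.ncard : ℤ) + ⌈((PP.uncov S).ncard : ℚ) / 2⌉ := by
  obtain ⟨S', hsat, hsub, hle⟩ :=
    PP.exists_saturating_superset (((PP.uncov S).ncard + 1) / 2) S hS (by omega)
  refine ⟨S', hsat, hsub, ?_⟩
  have hceil := Int.le_ceil (((PP.uncov S).ncard : ℚ) / 2)
  rw [div_le_iff₀ two_pos] at hceil
  have hceil' : ((PP.uncov S).ncard : ℤ) ≤ ⌈((PP.uncov S).ncard : ℚ) / 2⌉ * 2 := by
    exact_mod_cast hceil
  omega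
end

section
/- Let Π be a projective plane of order q and let S be a saturating set of Π. Then |S| > √(2q) + 1. -/
namespace ProjPlane

variable {q : ℕ} (PP : ProjPlane q)

theorem line_eq {P Q : PP.Point} (h : P ≠ Q) {l m : PP.Line} (hPl : PP.incid P l)
    (hQl : PP.incid Q l) (hPm : PP.incid P m) (hQm : PP.incid Q m) : l = m :=
  (PP.line_unique P Q h).unique ⟨hPl, hQl⟩ ⟨hPm, hQm⟩

theorem exists_line_not_incid (P : PP.Point) : ∃ l : PP.Line, ¬ PP.incid P l := by
  obtain ⟨A, B, C, -, hAB, hAC, -, hBC, -, -, hABC, -⟩ := PP.nondeg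
  by_contra! h
  obtain ⟨l, ⟨hAl, hBl⟩, -⟩ := PP.line_unique A B hAB
  obtain ⟨m, ⟨hAm, hCm⟩, -⟩ := PP.line_unique A C hAC
  obtain ⟨k, ⟨hBk, hCk⟩, -⟩ := PP.line_unique B C hBC
  rcases eq_or_ne P A with rfl | hPA
  · exact hABC k ⟨h k, hBk, hCk⟩
  · obtain rfl := PP.line_eq hPA (h l) hAl (h m) hAm
    exact hABC l ⟨hAl, hBl, hCm⟩

/-- A point of a set with at most `q + 1` points lies on a line tangent to the set. -/
theorem exists_tangent [DecidableEq PP.Point] (S : Finset PP.Point) {P : PP.Point} (hP : P ∈ S)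
    (hS : S.card ≤ q + 1) :
    ∃ l : PP.Line, PP.incid P l ∧ ∀ A ∈ S, PP.incid A l → A = P := by
  have := PP.finite_point
  obtain ⟨m, hm⟩ := PP.exists_line_not_incid P
  by_contra! h
  have secant : ∀ X : {X : PP.Point // PP.incid X m}, ∃ A : {A // A ∈ S.erase P},
      ∃ l, PP.incid P l ∧ PP.incid A l ∧ PP.incid X l := by
    rintro ⟨X, hX⟩
    have hPX : P ≠ X := by
      rintro rfl
      exact hm hX
    obtain ⟨l, ⟨hPl, hXl⟩, -⟩ := PP.line_unique P X hPX
    obtain ⟨A, hA, hAl, hAP⟩ := h l hPl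
    exact ⟨⟨A, Finset.mem_erase.2 ⟨hAP, hA⟩⟩, l, hPl, hAl, hXl⟩
  choose f l hPl hfl hXl using secant
  have hf : Function.Injective f := by
    intro X Y hXY
    have hne : P ≠ f X := (Finset.ne_of_mem_erase (f X).2).symm
    have hl : l X = l Y := PP.line_eq hne (hPl X) (hfl X) (hPl Y) (hXY ▸ hfl Y)
    by_contra hXneY
    have hlm : l X = m := PP.line_eq (fun e => hXneY (Subtype.ext e)) (hXl X)
      (hl ▸ hXl Y) X.2 Y.2
    exact hm (hlm ▸ hPl X)
  have hcard := Nat.card_le_card_of_injective f hf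
  rw [PP.line_card, Nat.card_eq_fintype_card, Fintype.card_coe, Finset.card_erase_of_mem hP]
    at hcard
  have := Finset.card_pos.2 ⟨P, hP⟩
  omega

/-- The points of a tangent line other than the point of tangency are covered by the secants
of the remaining points of the saturating set. -/
theorem le_choose_two_of_tangent [DecidableEq PP.Point] (S : Finset PP.Point)
    (hS : PP.Saturating (S : Set PP.Point)) {P : PP.Point} (hP : P ∈ S) {l : PP.Line}
    (hPl : PP.incid P l) (htan : ∀ A ∈ S, PP.incid A l → A = P) :
    q ≤ (S.card - 1).choose 2 := by
  classical
  have := PP.finite_point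
  have := Fintype.ofFinite PP.Point
  have secant : ∀ X : {X : PP.Point // PP.incid X l ∧ X ≠ P},
      ∃ s : {s // s ∈ (S.erase P).powersetCard 2}, ∃ m, m ≠ l ∧ PP.incid X m ∧
        ∀ A ∈ s.1, PP.incid A m := by
    rintro ⟨X, hXl, hXP⟩
    obtain ⟨A, hA, B, hB, hAB, m, hAm, hBm, hXm⟩ := hS X fun hX => hXP (htan X hX hXl)
    have hml : m ≠ l := by
      rintro rfl
      exact hAB ((htan A hA hAm).trans (htan B hB hBm).symm)
    have hPm : ¬ PP.incid P m := fun hPm => hml (PP.line_eq hXP hXm hPm hXl hPl)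
    have hne : ∀ C, PP.incid C m → C ≠ P := by
      rintro C hC rfl
      exact hPm hC
    refine ⟨⟨{A, B}, Finset.mem_powersetCard.2 ⟨?_, Finset.card_pair hAB⟩⟩, m, hml, hXm, ?_⟩
    · simpa [Finset.insert_subset_iff] using ⟨⟨hne A hAm, hA⟩, hne B hBm, hB⟩
    · simpa using ⟨hAm, hBm⟩
  choose f m hml hXm hfm using secant
  have hf : Function.Injective f := by
    intro X Y hXY
    obtain ⟨A, B, hAB, hs⟩ := Finset.card_eq_two.1 (Finset.mem_powersetCard.1 (f X).2).2
    have hA : A ∈ (f X).1 := by simp [hs]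
    have hB : B ∈ (f X).1 := by simp [hs]
    have hm : m X = m Y := PP.line_eq hAB (hfm X A hA) (hfm X B hB)
      (hfm Y A (hXY ▸ hA)) (hfm Y B (hXY ▸ hB))
    by_contra hXneY
    exact hml X (PP.line_eq (fun e => hXneY (Subtype.ext e)) (hXm X) (hm ▸ hXm Y) X.2.1 Y.2.1)
  have hcard := Nat.card_le_card_of_injective f hf
  rw [Nat.card_eq_fintype_card (α := {s // s ∈ (S.erase P).powersetCard 2}), Fintype.card_coe,
    Finset.card_powersetCard, Finset.card_erase_of_mem hP] at hcard
  have hline := PP.line_card l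
  rw [Nat.card_eq_fintype_card, Fintype.card_subtype] at hline
  have herase : ({X | PP.incid X l ∧ X ≠ P} : Finset PP.Point)
      = ({X | PP.incid X l} : Finset PP.Point).erase P := by
    ext X
    simp [and_comm]
  rw [Nat.card_eq_fintype_card, Fintype.card_subtype, herase,
    Finset.card_erase_of_mem (by simpa using hPl), hline] at hcard
  simpa using hcard

theorem Saturating.one_lt_card {S : Finset PP.Point} (hS : PP.Saturating (S : Set PP.Point)) :
    1 < S.card := by
  obtain ⟨A, B, -, -, hAB, -⟩ := PP.nondeg
  rw [Finset.one_lt_card]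
  by_cases h : A ∈ S ∧ B ∈ S
  · exact ⟨A, h.1, B, h.2, hAB⟩
  · obtain ⟨Q, hQ⟩ : ∃ Q, Q ∉ S := by
      by_contra! hall
      exact h ⟨hall A, hall B⟩
    obtain ⟨C, hC, D, hD, hCD, -⟩ := hS Q (by simpa using hQ)
    exact ⟨C, by simpa using hC, D, by simpa using hD, hCD⟩

theorem Saturating.two_mul_lt_sq {S : Finset PP.Point}
    (hS : PP.Saturating (S : Set PP.Point)) : 2 * q < (S.card - 1) ^ 2 := by
  classical
  have hone := hS.one_lt_card
  obtain ⟨n, hn⟩ : ∃ n, S.card = n + 2 := ⟨S.card - 2, by omega⟩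
  rcases le_or_gt S.card (q + 1) with hle | hgt
  · obtain ⟨P, hP⟩ := Finset.card_pos.1 (zero_lt_one.trans hone)
    obtain ⟨l, hPl, htan⟩ := PP.exists_tangent S hP hle
    have hq := PP.le_choose_two_of_tangent S hS hP hPl htan
    rw [hn, Nat.choose_two_right, Nat.le_div_iff_mul_le two_pos] at hq
    rw [hn]
    simp only [Nat.add_succ_sub_one, add_tsub_cancel_right] at hq ⊢
    nlinarith
  · rw [hn] at hgt ⊢
    simp only [Nat.add_succ_sub_one]
    nlinarith

end ProjPlane

theorem saturating_lower_bound (q : ℕ) (PP : ProjPlane q)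
    (S : Set PP.Point) (hS : PP.Saturating S) :
    Real.sqrt (2 * q) + 1 < (S.ncard : ℝ) := by
  have := PP.finite_point
  lift S to Finset PP.Point using S.toFinite
  rw [Set.ncard_coe_finset, ← lt_sub_iff_add_lt]
  have hone : 1 ≤ S.card := hS.one_lt_card.le
  have hsq := hS.two_mul_lt_sq
  rw [← Nat.cast_lt (α := ℝ)] at hsq
  push_cast [Nat.cast_sub hone] at hsq
  have hpos : (1 : ℝ) < S.card := by exact_mod_cast hS.one_lt_card
  exact (Real.sqrt_lt' (by linarith)).2 hsq
end
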